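/- Fix n ≥ 2 and k ≥ 1. The map Ε : D̂_{n-1}(k) → CD_n(k) defined by Ε((s₁,c₁),…,(s_k,c_k)) = ((s₁/(2√2), (0, c₁/2)), …, (s_k/(2√2), (0, c_k/2))), where (0, c) ∈ ℝⁿ denotes the point with time coordinate 0 and spatial part c, is well defined (its values lie in CD_n(k)) and is a topological embedding (a homeomorphism onto its image). -/

import Mathlib

open Set Metric unitInterval

noncomputable section

/-- `n`-dimensional Minkowski space, modeled as `ℝⁿ` with the Euclidean norm. -/
abbrev Mink (n : ℕ) := EuclideanSpace ℝ (Fin n)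

/-- The spatial part `x⃗ = (x 1, …, x (n-1)) ∈ ℝ^{n-1}` of `x ∈ ℝⁿ`. -/
def spatial {n : ℕ} (x : Mink n) : Mink (n - 1) :=
  (WithLp.equiv 2 _).symm fun i : Fin (n - 1) => x ⟨i.1 + 1, by have := i.isLt; omega⟩

/-- A curve `γ` is future-directed causal if it is `C¹` and
`(γ₀)'(t) ≥ ‖(γ⃗)'(t)‖` for all `t ∈ [0,1]`. -/
def FDCausal {n : ℕ} [NeZero n] (γ : ℝ → Mink n) : Prop :=
  ContDiff ℝ 1 γ ∧
    ∀ t ∈ Set.Icc (0 : ℝ) 1,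
      ‖deriv (fun s => spatial (γ s)) t‖ ≤ deriv (fun s => γ s 0) t

/-- A curve `γ` is past-directed causal if it is `C¹` and
`-(γ₀)'(t) ≥ ‖(γ⃗)'(t)‖` for all `t ∈ [0,1]`. -/
def PDCausal {n : ℕ} [NeZero n] (γ : ℝ → Mink n) : Prop :=
  ContDiff ℝ 1 γ ∧
    ∀ t ∈ Set.Icc (0 : ℝ) 1,
      ‖deriv (fun s => spatial (γ s)) t‖ ≤ -(deriv (fun s => γ s 0) t)

/-- A causal curve is a future- or past-directed causal curve. -/
def IsCausalCurve {n : ℕ} [NeZero n] (γ : ℝ → Mink n) : Prop :=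
  FDCausal γ ∨ PDCausal γ

/-- `S` and `T` are causally disjoint if no causal curve starts in `S` and ends in `T`. -/
def CausallyDisjoint {n : ℕ} [NeZero n] (S T : Set (Mink n)) : Prop :=
  ¬ ∃ γ : ℝ → Mink n, IsCausalCurve γ ∧ γ 0 ∈ S ∧ γ 1 ∈ T

/-- The point of `ℝⁿ` with time coordinate `0` and spatial part `c ∈ ℝ^{n-1}`. -/
def fromSpatial {n : ℕ} (c : Mink (n - 1)) : Mink n :=
  (WithLp.equiv 2 _).symm fun i : Fin n =>
    if h : i.1 = 0 then 0 else c ⟨i.1 - 1, by have := i.isLt; omega⟩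

/-- The space `CD_n(k)` of `k` causally disjoint rectilinear discs in the unit disc,
recorded as tuples of (radius, center). -/
def CDset (n : ℕ) [NeZero n] (k : ℕ) : Set (Fin k → ℝ × Mink n) :=
  {f | (∀ i, 0 < (f i).1 ∧ (f i).1 + ‖(f i).2‖ ≤ 1) ∧
    ∀ i j, i ≠ j →
      CausallyDisjoint (closedBall (f i).2 (f i).1) (closedBall (f j).2 (f j).1)}

/-- The space `D̂_m(k)` of `k` little `m`-discs with disjoint closures,
recorded as tuples of (radius, center). -/
def DhatSet (m k : ℕ) : Set (Fin k → ℝ × Mink m) :=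
  {f | (∀ i, 0 < (f i).1 ∧ (f i).1 + ‖(f i).2‖ ≤ 1) ∧
    ∀ i j, i ≠ j →
      Disjoint (closedBall (f i).2 (f i).1) (closedBall (f j).2 (f j).1)}

/-- The map underlying the embedding `ε : D̂_{n-1}(k) → CD_n(k)`: each little
`(n-1)`-disc `(s, c)` is scaled by `1/2`, placed in the `{t = 0}` hyperplane, and
replaced by the maximal inscribed `n`-disc of its double cone of angle `π/4`. -/
def epsMap (n k : ℕ) : (Fin k → ℝ × Mink (n - 1)) → (Fin k → ℝ × Mink n) :=
  fun f i => ((f i).1 / (2 * Real.sqrt 2), fromSpatial ((2⁻¹ : ℝ) • (f i).2))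

theorem norm_sq_eq_time_add_spatial {n : ℕ} [NeZero n] (x : Mink n) :
    ‖x‖ ^ 2 = x 0 ^ 2 + ‖spatial x‖ ^ 2 := by
  obtain _ | m := n
  · exact absurd rfl (NeZero.ne 0)
  · rw [EuclideanSpace.norm_sq_eq, EuclideanSpace.norm_sq_eq, Fin.sum_univ_succ]
    simp only [Real.norm_eq_abs, sq_abs]
    rfl

theorem spatial_sub {n : ℕ} (x y : Mink n) : spatial (x - y) = spatial x - spatial y := rfl

theorem spatial_fromSpatial {n : ℕ} (c : Mink (n - 1)) :
    spatial (fromSpatial c : Mink n) = c := by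
  ext i
  simp [spatial, fromSpatial]

theorem fromSpatial_zero_coord {n : ℕ} [NeZero n] (c : Mink (n - 1)) :
    (fromSpatial c : Mink n) 0 = 0 := by
  simp [fromSpatial]

theorem norm_fromSpatial {n : ℕ} [NeZero n] (c : Mink (n - 1)) :
    ‖(fromSpatial c : Mink n)‖ = ‖c‖ := by
  have h := norm_sq_eq_time_add_spatial (fromSpatial c : Mink n)
  rw [spatial_fromSpatial, fromSpatial_zero_coord] at h
  exact (sq_eq_sq₀ (norm_nonneg _) (norm_nonneg _)).1 (by linarith)

theorem contDiff_spatial {n : ℕ} : ContDiff ℝ 1 (spatial : Mink n → Mink (n - 1)) := by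
  rw [contDiff_euclidean]
  intro i
  simp only [spatial]
  exact contDiff_piLp_apply 2

theorem continuous_fromSpatial {n : ℕ} :
    Continuous (fromSpatial : Mink (n - 1) → Mink n) := by
  refine (PiLp.continuous_toLp 2 _).comp (continuous_pi fun i => ?_)
  split_ifs
  · exact continuous_const
  · fun_prop

/-- A `C¹` curve whose spatial speed is bounded by the speed of a `C¹` time function moves at most
as far in space as in time. -/
theorem norm_sub_le_of_norm_deriv_le_deriv {E : Type*} [NormedAddCommGroup E] [NormedSpace ℝ E]
    {f : ℝ → E} {B : ℝ → ℝ} (hf : Differentiable ℝ f) (hB : Differentiable ℝ B)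
    (h : ∀ t ∈ Icc (0 : ℝ) 1, ‖deriv f t‖ ≤ deriv B t) :
    ‖f 1 - f 0‖ ≤ B 1 - B 0 := by
  refine image_norm_le_of_norm_deriv_right_le_deriv_boundary (a := 0) (b := 1)
    (f := fun t => f t - f 0) (B := fun t => B t - B 0) (f' := deriv f) (B' := deriv B)
    (hf.continuous.sub continuous_const).continuousOn
    (fun x _ => ((hf x).hasDerivAt.sub_const _).hasDerivWithinAt) (by simp)
    (fun x => (hB x).hasDerivAt.sub_const _)
    (fun x hx => h x ⟨hx.1, hx.2.le⟩) ⟨zero_le_one, le_rfl⟩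

theorem IsCausalCurve.norm_spatial_sub_le {n : ℕ} [NeZero n] {γ : ℝ → Mink n}
    (h : IsCausalCurve γ) :
    ‖spatial (γ 1) - spatial (γ 0)‖ ≤ |γ 1 0 - γ 0 0| := by
  have hγ : ContDiff ℝ 1 γ := h.elim And.left And.left
  have hs : Differentiable ℝ fun s => spatial (γ s) :=
    (contDiff_spatial.comp hγ).differentiable one_ne_zero
  have ht : Differentiable ℝ fun s => γ s 0 :=
    ((contDiff_piLp_apply 2).comp hγ).differentiable one_ne_zero
  rcases h with h | h
  · exact (norm_sub_le_of_norm_deriv_le_deriv hs ht h.2).trans (le_abs_self _)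
  · have := norm_sub_le_of_norm_deriv_le_deriv hs ht.neg
      (fun t hm => by rw [deriv.neg]; exact h.2 t hm)
    refine this.trans (le_trans (le_of_eq ?_) (neg_le_abs _))
    simp only [Pi.neg_apply]
    ring

/-- A ball of radius `s / (2√2)` around a point of the time-zero slice lies in the double cone
over the spatial ball of radius `s / 2`. -/
theorem abs_time_add_norm_spatial_sub_le {n : ℕ} [NeZero n] {s : ℝ} (hs : 0 ≤ s)
    {c : Mink (n - 1)} {x : Mink n}
    (hx : x ∈ closedBall (fromSpatial c) (s / (2 * Real.sqrt 2))) :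
    |x 0| + ‖spatial x - c‖ ≤ s / 2 := by
  rw [mem_closedBall, dist_eq_norm] at hx
  have h := norm_sq_eq_time_add_spatial (x - fromSpatial c)
  rw [spatial_sub, spatial_fromSpatial, PiLp.sub_apply, fromSpatial_zero_coord, sub_zero,
    ← sq_abs (x 0)] at h
  have h2 := pow_le_pow_left₀ (norm_nonneg _) hx 2
  rw [div_pow, mul_pow, Real.sq_sqrt zero_le_two] at h2
  refine abs_le_of_sq_le_sq' ?_ (by positivity) |>.2
  nlinarith [sq_nonneg (|x 0| - ‖spatial x - c‖)]

theorem causallyDisjoint_closedBall_fromSpatial {n : ℕ} [NeZero n] {s t : ℝ} (hs : 0 ≤ s)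
    (ht : 0 ≤ t) {c d : Mink (n - 1)} (h : Disjoint (closedBall c s) (closedBall d t)) :
    CausallyDisjoint
      (closedBall (fromSpatial ((2⁻¹ : ℝ) • c) : Mink n) (s / (2 * Real.sqrt 2)))
      (closedBall (fromSpatial ((2⁻¹ : ℝ) • d)) (t / (2 * Real.sqrt 2))) := by
  rintro ⟨γ, hγ, h0, h1⟩
  rw [disjoint_closedBall_closedBall_iff hs ht] at h
  have e0 := abs_time_add_norm_spatial_sub_le hs h0
  have e1 := abs_time_add_norm_spatial_sub_le ht h1
  have hc := hγ.norm_spatial_sub_le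
  have hd : dist ((2⁻¹ : ℝ) • c) ((2⁻¹ : ℝ) • d) = 2⁻¹ * dist c d := by
    rw [dist_smul₀]; norm_num
  have tri := dist_triangle4 ((2⁻¹ : ℝ) • c) (spatial (γ 0)) (spatial (γ 1)) ((2⁻¹ : ℝ) • d)
  rw [hd, dist_comm _ (spatial (γ 0)), dist_comm (spatial (γ 0)) (spatial (γ 1))] at tri
  simp only [dist_eq_norm (spatial _)] at tri
  have := abs_sub (γ 1 0) (γ 0 0)
  linarith

theorem isEmbedding_epsMap (n k : ℕ) : Topology.IsEmbedding (epsMap n k) := by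
  refine Topology.IsEmbedding.of_leftInverse
    (f := fun g i => (2 * Real.sqrt 2 * (g i).1, (2 : ℝ) • spatial (g i).2)) ?_ ?_ ?_
  · intro f
    funext i
    ext1
    · simp only [epsMap]
      field_simp
    · simp [epsMap, spatial_fromSpatial]
  · have := (contDiff_spatial (n := n)).continuous
    fun_prop
  · have := continuous_fromSpatial (n := n)
    unfold epsMap
    fun_prop

/-- The map `ε` is well defined (sends `D̂_{n-1}(k)` into `CD_n(k)`) and is a
topological embedding. -/
theorem epsMap_wellDefined_isEmbedding (n k : ℕ) [NeZero n] (hn : 2 ≤ n) (hk : 1 ≤ k) :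
    Set.MapsTo (epsMap n k) (DhatSet (n - 1) k) (CDset n k) ∧
      Topology.IsEmbedding (fun f : DhatSet (n - 1) k => epsMap n k f.1) := by
  refine ⟨fun f hf => ⟨fun i => ?_, fun i j hij => ?_⟩,
    (isEmbedding_epsMap n k).comp Topology.IsEmbedding.subtypeVal⟩
  · obtain ⟨hpos, hle⟩ := hf.1 i
    refine ⟨by simp only [epsMap]; positivity, ?_⟩
    have h1 : (f i).1 / (2 * Real.sqrt 2) ≤ (f i).1 :=
      div_le_self hpos.le (by linarith [Real.one_le_sqrt.2 (one_le_two (α := ℝ))])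
    simp only [epsMap]
    rw [norm_fromSpatial, norm_smul, Real.norm_of_nonneg (by norm_num)]
    linarith [norm_nonneg (f i).2]
  · exact causallyDisjoint_closedBall_fromSpatial (hf.1 i).1.le (hf.1 j).1.le (hf.2 i j hij)
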